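/- Let α, β ∈ ℂ with α ≠ 0, β ≠ 0, α ≠ β, and α, β not negative integers. Define g(n) = (α/β)(n+β)/(n+α), μ(n) = n/(n+α), and ψ(n) = (g(n) - g(1)g(n-1))/(μ(1)μ(n-1)) for n ≥ 2. Then for all m, n ≥ 1 with m + n ≥ 2: g(n+m) = g(n)g(m) + μ(n)μ(m)ψ(n+m). -/

import Mathlib

/-- The addition law with `ψ` replaced by its closed form as a function of `x + y`. -/
theorem krallJacobi_addition {K : Type*} [Field K] {α β x y : K} (hβ : β ≠ 0)
    (hx : x + α ≠ 0) (hy : y + α ≠ 0) (hxy : x + y + α ≠ 0) :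
    α / β * ((x + y + β) / (x + y + α)) =
      α / β * ((x + β) / (x + α)) * (α / β * ((y + β) / (y + α))) +
        x / (x + α) * (y / (y + α)) *
          (α * (β * (x + y + β) - α * (x + y + α)) / (β ^ 2 * (x + y + α))) := by
  field_simp
  ring

theorem stmt_7 (α β : ℂ) (hα : α ≠ 0) (hβ : β ≠ 0) (hαβ : α ≠ β)
    (hαn : ∀ n : ℕ, α + n ≠ 0) (hβn : ∀ n : ℕ, β + n ≠ 0)
    (g μ ψ : ℕ → ℂ)
    (hg : ∀ n : ℕ, g n = (α/β) * (((n : ℂ) + β)/((n : ℂ) + α)))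
    (hμ : ∀ n : ℕ, μ n = (n : ℂ)/((n : ℂ) + α))
    (hψ : ∀ n : ℕ, 2 ≤ n → ψ n = (g n - g 1 * g (n-1))/(μ 1 * μ (n-1))) :
    ∀ m n : ℕ, 1 ≤ m → 1 ≤ n → 2 ≤ m + n →
      g (n+m) = g n * g m + μ n * μ m * ψ (n+m) := by
  have hα' (k : ℕ) : (k : ℂ) + α ≠ 0 := by simpa only [add_comm] using hαn k
  have hμ0 (k : ℕ) (hk : 1 ≤ k) : μ k ≠ 0 := by
    rw [hμ]
    exact div_ne_zero (Nat.cast_ne_zero.2 (by omega)) (hα' k)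
  have addition (a b : ℕ) : g (a + b) = g a * g b + μ a * μ b *
      (α * (β * ((a + b : ℕ) + β) - α * ((a + b : ℕ) + α)) / (β ^ 2 * ((a + b : ℕ) + α))) := by
    have hab := hα' (a + b)
    simp only [hg, hμ]
    push_cast at hab ⊢
    exact krallJacobi_addition hβ (hα' a) (hα' b) hab
  intro m n hm hn hmn
  have hs := addition 1 (n + m - 1)
  rw [show 1 + (n + m - 1) = n + m by omega] at hs
  have hψs : ψ (n + m) = α * (β * ((n + m : ℕ) + β) - α * ((n + m : ℕ) + α)) /
      (β ^ 2 * ((n + m : ℕ) + α)) := by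
    rw [hψ _ (by omega), div_eq_iff
      (mul_ne_zero (hμ0 1 le_rfl) (hμ0 (n + m - 1) (by omega)))]
    linear_combination hs
  rw [hψs]
  exact addition n m
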